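/- arXiv:1212.2648 — 2 statements merged into one kernel-verified Lean document; each statement's English description precedes it below -/
import Mathlib

section
/- (Lemma 1) Fix N ≥ 2 and let Λ₀ = I^{⊗(N−1)} ⊗ X. Let G be the subgroup of the unitary group U(2^N) generated by all embedded C-NOT gates V_{jk} (1 ≤ j ≠ k ≤ N) together with all local one-qubit unitary gates. Then for every Λ ∈ 𝓛_N there exists W ∈ G such that W · Λ₀ · W† = Λ. In particular, starting from I^{⊗(N−1)} ⊗ X one can generate the whole basis 𝓛_N by conjugation with C-NOTs and local gates. -/
open Matrix

noncomputable section

/-- The Pauli matrices `I, X, Y, Z`, indexed by `Fin 4`. -/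
def pauli (i : Fin 4) : Matrix (Fin 2) (Fin 2) ℂ :=
  if i = 0 then 1
  else if i = 1 then !![0, 1; 1, 0]
  else if i = 2 then !![0, -Complex.I; Complex.I, 0]
  else !![1, 0; 0, -1]

/-- The `N`-fold Kronecker/tensor product `L₁ ⊗ ⋯ ⊗ L_N` of `2×2` matrices, realized as a
`2^N × 2^N` matrix indexed by bit strings `Fin N → Fin 2`. -/
def tensorString {N : ℕ} (M : Fin N → Matrix (Fin 2) (Fin 2) ℂ) :
    Matrix (Fin N → Fin 2) (Fin N → Fin 2) ℂ :=
  Matrix.of fun r c => ∏ j, M j (r j) (c j)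

/-- The embedded C-NOT gate with control `j` and target `k`: it sends the basis vector labelled
`b` to the basis vector labelled `b` with the `k`-th bit replaced by `b j + b k` (mod 2). -/
def cnot {N : ℕ} (j k : Fin N) : Matrix (Fin N → Fin 2) (Fin N → Fin 2) ℂ :=
  Matrix.of fun r c => if r = Function.update c k (c j + c k) then 1 else 0

/-- A local one-qubit gate `U` acting on qubit `k`. -/
def localGate {N : ℕ} (k : Fin N) (U : Matrix (Fin 2) (Fin 2) ℂ) :
    Matrix (Fin N → Fin 2) (Fin N → Fin 2) ℂ :=
  tensorString fun j => if j = k then U else 1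

theorem tensorString_mul {N : ℕ} (A B : Fin N → Matrix (Fin 2) (Fin 2) ℂ) :
    tensorString A * tensorString B = tensorString fun j => A j * B j := by
  ext r c
  simp only [tensorString, Matrix.mul_apply, Matrix.of_apply, Finset.prod_univ_sum,
    Fintype.piFinset_univ, Finset.prod_mul_distrib]

theorem tensorString_conjTranspose {N : ℕ} (A : Fin N → Matrix (Fin 2) (Fin 2) ℂ) :
    (tensorString A)ᴴ = tensorString fun j => (A j)ᴴ := by
  ext r c
  simp [tensorString, Matrix.conjTranspose_apply, star_prod]

theorem tensorString_one {N : ℕ} :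
    tensorString (fun _ : Fin N => (1 : Matrix (Fin 2) (Fin 2) ℂ)) = 1 := by
  ext r c
  simp [tensorString, Matrix.one_apply, Finset.prod_ite_zero, funext_iff]

theorem localGate_conj_tensorString {N : ℕ} (k : Fin N) (U : Matrix (Fin 2) (Fin 2) ℂ)
    (M : Fin N → Matrix (Fin 2) (Fin 2) ℂ) :
    localGate k U * tensorString M * (localGate k U)ᴴ =
      tensorString (Function.update M k (U * M k * Uᴴ)) := by
  rw [localGate, tensorString_conjTranspose, tensorString_mul, tensorString_mul]
  congr 1
  ext1 j
  by_cases h : j = k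
  · subst h
    simp
  · simp [h]

theorem localGate_mem_unitaryGroup {N : ℕ} (k : Fin N) {U : Matrix (Fin 2) (Fin 2) ℂ}
    (hU : U ∈ Matrix.unitaryGroup (Fin 2) ℂ) :
    localGate k U ∈ Matrix.unitaryGroup (Fin N → Fin 2) ℂ := by
  rw [Matrix.mem_unitaryGroup_iff, Matrix.star_eq_conjTranspose] at hU ⊢
  have h := localGate_conj_tensorString k U fun _ => 1
  rw [tensorString_one, mul_one, mul_one, hU] at h
  rw [h, ← tensorString_one]
  congr 1
  exact Function.update_eq_self k _

/-- The action of the C-NOT gate with control `j` and target `k` on bit strings. -/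
def cnotBits {N : ℕ} (j k : Fin N) (b : Fin N → Fin 2) : Fin N → Fin 2 :=
  Function.update b k (b j + b k)

theorem cnotBits_involutive {N : ℕ} {j k : Fin N} (h : j ≠ k) :
    Function.Involutive (cnotBits j k) := by
  intro b
  have h2 : ∀ x y : Fin 2, x + (x + y) = y := by decide
  simp [cnotBits, h, h2]

theorem cnotBits_add {N : ℕ} (j k : Fin N) (b c : Fin N → Fin 2) :
    cnotBits j k (b + c) = cnotBits j k b + cnotBits j k c := by
  ext1 i
  by_cases h : i = k
  · subst h
    simp [cnotBits, add_add_add_comm]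
  · simp [cnotBits, h]

theorem cnot_conjTranspose {N : ℕ} {j k : Fin N} (h : j ≠ k) : (cnot j k)ᴴ = cnot j k := by
  ext r c
  have hrc : c = cnotBits j k r ↔ r = cnotBits j k c :=
    eq_comm.trans (cnotBits_involutive h).eq_iff
  rw [cnotBits, cnotBits] at hrc
  simp [cnot, Matrix.conjTranspose_apply, hrc, apply_ite]

theorem mul_cnot_apply {N : ℕ} (j k : Fin N) (A : Matrix (Fin N → Fin 2) (Fin N → Fin 2) ℂ)
    (r c : Fin N → Fin 2) : (A * cnot j k) r c = A r (cnotBits j k c) := by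
  simp [Matrix.mul_apply, cnot, cnotBits]

theorem cnot_conj_apply {N : ℕ} {j k : Fin N} (h : j ≠ k)
    (A : Matrix (Fin N → Fin 2) (Fin N → Fin 2) ℂ) (r c : Fin N → Fin 2) :
    (cnot j k * A * (cnot j k)ᴴ) r c = A (cnotBits j k r) (cnotBits j k c) := by
  rw [cnot_conjTranspose h, mul_cnot_apply, ← Matrix.conjTranspose_conjTranspose (cnot j k * A),
    Matrix.conjTranspose_mul, cnot_conjTranspose h, Matrix.conjTranspose_apply, mul_cnot_apply,
    Matrix.conjTranspose_apply, star_star]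

theorem cnot_mem_unitaryGroup {N : ℕ} {j k : Fin N} (h : j ≠ k) :
    cnot j k ∈ Matrix.unitaryGroup (Fin N → Fin 2) ℂ := by
  rw [Matrix.mem_unitaryGroup_iff, Matrix.star_eq_conjTranspose]
  ext r c
  have hrc := cnot_conj_apply h 1 r c
  rw [mul_one] at hrc
  simp [hrc, Matrix.one_apply, (cnotBits_involutive h).injective.eq_iff]

/-- The Pauli string with `X` at the positions where `v` is `1` and `I` elsewhere. -/
def xString {N : ℕ} (v : Fin N → Fin 2) : Matrix (Fin N → Fin 2) (Fin N → Fin 2) ℂ :=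
  tensorString fun j => pauli (if v j = 1 then 1 else 0)

theorem xString_apply {N : ℕ} (v r c : Fin N → Fin 2) :
    xString v r c = if r = c + v then 1 else 0 := by
  have key : ∀ x y z : Fin 2,
      pauli (if x = 1 then 1 else 0) y z = if y = z + x then 1 else 0 := by
    intro x y z
    fin_cases x <;> fin_cases y <;> fin_cases z <;> simp [pauli]
  simp [xString, tensorString, key, Finset.prod_ite_zero, funext_iff]

theorem cnot_conj_xString {N : ℕ} {j k : Fin N} (h : j ≠ k) (v : Fin N → Fin 2) :
    cnot j k * xString v * (cnot j k)ᴴ = xString (cnotBits j k v) := by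
  ext r c
  have hrc : cnotBits j k r = cnotBits j k c + v ↔ r = c + cnotBits j k v := by
    rw [(cnotBits_involutive h).eq_iff, cnotBits_add, cnotBits_involutive h c]
  simp only [cnot_conj_apply h, xString_apply, hrc]

/-- The C-NOT gates and the local one-qubit unitary gates. -/
def elementaryGates (N : ℕ) : Set (Matrix.unitaryGroup (Fin N → Fin 2) ℂ) :=
  {W | (∃ j k, j ≠ k ∧ (W : Matrix (Fin N → Fin 2) (Fin N → Fin 2) ℂ) = cnot j k) ∨
    (∃ (k : Fin N) (U : Matrix (Fin 2) (Fin 2) ℂ), U ∈ Matrix.unitaryGroup (Fin 2) ℂ ∧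
      (W : Matrix (Fin N → Fin 2) (Fin N → Fin 2) ℂ) = localGate k U)}

/-- Conjugacy under the group generated by C-NOT gates and local unitary gates. -/
def GateConj {N : ℕ} (A B : Matrix (Fin N → Fin 2) (Fin N → Fin 2) ℂ) : Prop :=
  ∃ W ∈ Subgroup.closure (elementaryGates N),
    (W : Matrix (Fin N → Fin 2) (Fin N → Fin 2) ℂ) * A *
      (W : Matrix (Fin N → Fin 2) (Fin N → Fin 2) ℂ)ᴴ = B

namespace GateConj

variable {N : ℕ} {A B C : Matrix (Fin N → Fin 2) (Fin N → Fin 2) ℂ}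

theorem refl (A : Matrix (Fin N → Fin 2) (Fin N → Fin 2) ℂ) : GateConj A A :=
  ⟨1, one_mem _, by simp⟩

theorem trans (hAB : GateConj A B) (hBC : GateConj B C) : GateConj A C := by
  obtain ⟨V, hV, rfl⟩ := hAB
  obtain ⟨W, hW, rfl⟩ := hBC
  exact ⟨W * V, mul_mem hW hV, by simp [Matrix.mul_assoc]⟩

end GateConj

theorem gateConj_update {N : ℕ} (M : Fin N → Matrix (Fin 2) (Fin 2) ℂ) (k : Fin N)
    {U : Matrix (Fin 2) (Fin 2) ℂ} (hU : U ∈ Matrix.unitaryGroup (Fin 2) ℂ) :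
    GateConj (tensorString M) (tensorString (Function.update M k (U * M k * Uᴴ))) :=
  ⟨⟨localGate k U, localGate_mem_unitaryGroup k hU⟩,
    Subgroup.subset_closure (Or.inr ⟨k, U, hU, rfl⟩), localGate_conj_tensorString k U M⟩

theorem gateConj_tensorString {N : ℕ} {M M' : Fin N → Matrix (Fin 2) (Fin 2) ℂ}
    (h : ∀ k, ∃ U ∈ Matrix.unitaryGroup (Fin 2) ℂ, U * M k * Uᴴ = M' k) :
    GateConj (tensorString M) (tensorString M') := by
  have key : ∀ s : Finset (Fin N),
      GateConj (tensorString M) (tensorString (s.piecewise M' M)) := by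
    intro s
    induction s using Finset.induction_on with
    | empty => simpa using GateConj.refl _
    | insert k s hk ih =>
      obtain ⟨U, hU, hUk⟩ := h k
      refine ih.trans ?_
      rw [Finset.piecewise_insert, ← hUk]
      simpa [hk] using gateConj_update (s.piecewise M' M) k hU
  simpa using key Finset.univ

theorem gateConj_xString_of_apply_eq_one {N : ℕ} {v w : Fin N → Fin 2} {j : Fin N}
    (hv : v j = 1) (hw : w j = 1) : GateConj (xString v) (xString w) := by
  have key : ∀ s : Finset (Fin N), GateConj (xString v) (xString (s.piecewise w v)) := by
    intro s
    induction s using Finset.induction_on with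
    | empty => simpa using GateConj.refl _
    | insert k s hk ih =>
      refine ih.trans ?_
      rw [Finset.piecewise_insert]
      by_cases h : w k = s.piecewise w v k
      · rw [h, Function.update_eq_self]
        exact GateConj.refl _
      · have hj : s.piecewise w v j = 1 := by simp [Finset.piecewise, hv, hw]
        have hjk : j ≠ k := by
          rintro rfl
          exact h (hw.trans hj.symm)
        have hflip : ∀ x y : Fin 2, x ≠ y → x = 1 + y := by decide
        refine ⟨⟨cnot j k, cnot_mem_unitaryGroup hjk⟩,
          Subgroup.subset_closure (Or.inl ⟨j, k, hjk, rfl⟩), ?_⟩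
        rw [cnot_conj_xString hjk, cnotBits, hj, ← hflip _ _ h]
  simpa using key Finset.univ

theorem gateConj_xString {N : ℕ} {v w : Fin N → Fin 2} {j k : Fin N}
    (hv : v j = 1) (hw : w k = 1) : GateConj (xString v) (xString w) :=
  (gateConj_xString_of_apply_eq_one (w := fun _ => 1) hv rfl).trans
    (gateConj_xString_of_apply_eq_one rfl hw)

theorem exists_unitary_conj_pauli (i : Fin 4) :
    ∃ U ∈ Matrix.unitaryGroup (Fin 2) ℂ, U * pauli (if i = 0 then 0 else 1) * Uᴴ = pauli i := by
  fin_cases i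
  · exact ⟨1, one_mem _, by simp⟩
  · exact ⟨1, one_mem _, by simp⟩
  · refine ⟨!![1, 0; 0, Complex.I], ?_, ?_⟩
    · rw [Matrix.mem_unitaryGroup_iff, Matrix.star_eq_conjTranspose]
      ext r c
      fin_cases r <;> fin_cases c <;> simp [Matrix.mul_apply]
    · ext r c
      fin_cases r <;> fin_cases c <;> simp [pauli, Matrix.mul_apply]
  · have hc : (1 + Complex.I) / 2 * ((1 - Complex.I) / 2) = 1 / 2 := by
      linear_combination (-1 / 4) * Complex.I_sq
    refine ⟨!![(1 + Complex.I) / 2, (1 + Complex.I) / 2;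
      (1 + Complex.I) / 2, -((1 + Complex.I) / 2)], ?_, ?_⟩
    · rw [Matrix.mem_unitaryGroup_iff, Matrix.star_eq_conjTranspose]
      ext r c
      fin_cases r <;> fin_cases c <;>
        simp [Matrix.mul_apply, ← sub_eq_add_neg, Complex.conj_ofNat, hc] <;> norm_num
    · ext r c
      fin_cases r <;> fin_cases c <;>
        simp [pauli, Matrix.mul_apply, ← sub_eq_add_neg, Complex.conj_ofNat, hc] <;> norm_num

/-- (Lemma 1)  Starting from `Λ₀ = I^{⊗(N-1)} ⊗ X`, conjugation by elements of the group
generated by C-NOTs and local unitary gates produces every Pauli string `Λ ∈ 𝓛_N`. -/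
theorem generate_pauli_strings_from_IX (N : ℕ) (hN : 2 ≤ N) :
    ∀ f : Fin N → Fin 4, f ≠ (fun _ => 0) →
      ∃ W ∈ Subgroup.closure
          {W : Matrix.unitaryGroup (Fin N → Fin 2) ℂ |
            (∃ j k, j ≠ k ∧ (W : Matrix (Fin N → Fin 2) (Fin N → Fin 2) ℂ) = cnot j k) ∨
            (∃ (k : Fin N) (U : Matrix (Fin 2) (Fin 2) ℂ), U ∈ Matrix.unitaryGroup (Fin 2) ℂ ∧
              (W : Matrix (Fin N → Fin 2) (Fin N → Fin 2) ℂ) = localGate k U)},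
        (W : Matrix (Fin N → Fin 2) (Fin N → Fin 2) ℂ) *
            tensorString (fun j => pauli (if (j : ℕ) = N - 1 then 1 else 0)) *
            (W : Matrix (Fin N → Fin 2) (Fin N → Fin 2) ℂ)ᴴ
          = tensorString fun j => pauli (f j) := by
  intro f hf
  obtain ⟨k, hk⟩ := Function.ne_iff.mp hf
  have hX : GateConj
      (xString fun j : Fin N => if (j : ℕ) = N - 1 then 1 else 0)
      (xString fun j => if f j = 0 then 0 else 1) :=
    gateConj_xString (j := ⟨N - 1, by omega⟩) (k := k) (if_pos rfl) (if_neg hk)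
  have hf' := hX.trans <| gateConj_tensorString (M' := fun j => pauli (f j)) fun j => by
    obtain ⟨U, hU, h⟩ := exists_unitary_conj_pauli (f j)
    exact ⟨U, hU, by by_cases h0 : f j = 0 <;> simpa [h0] using h⟩
  simp only [xString, ite_eq_left_iff, zero_ne_one, imp_false, not_not] at hf'
  exact hf'
end
end

section
/- (Strong universality of C-NOT for complex quantum computation) Fix N ≥ 2 and let G be the subgroup of the unitary group U(2^N) generated by all embedded C-NOT gates V_{jk} (1 ≤ j ≠ k ≤ N) together with all local one-qubit unitary gates. Then G contains every element of the special unitary group SU(2^N). -/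
open Matrix

noncomputable section

/-- The bit-flip gate. -/
def pauliX : Matrix (Fin 2) (Fin 2) ℂ := !![0, 1; 1, 0]

theorem pauliX_mem_unitaryGroup : pauliX ∈ unitaryGroup (Fin 2) ℂ := by
  rw [mem_unitaryGroup_iff]
  ext i j
  fin_cases i <;> fin_cases j <;> simp [pauliX, Matrix.mul_apply, Fin.sum_univ_two]

theorem star_mem_specialUnitaryGroup {n : Type*} [DecidableEq n] [Fintype n] {U : Matrix n n ℂ}
    (hU : U ∈ specialUnitaryGroup n ℂ) : star U ∈ specialUnitaryGroup n ℂ := by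
  obtain ⟨hu, hd⟩ := mem_specialUnitaryGroup_iff.1 hU
  refine mem_specialUnitaryGroup_iff.2 ⟨Unitary.star_mem hu, ?_⟩
  rw [star_eq_conjTranspose, det_conjTranspose, hd, star_one]

theorem mem_specialUnitaryGroup_fin_two_of {a b : ℂ} (h : a * star a + b * star b = 1) :
    !![a, -star b; b, star a] ∈ specialUnitaryGroup (Fin 2) ℂ := by
  rw [mem_specialUnitaryGroup_iff]
  refine ⟨?_, ?_⟩
  · rw [mem_unitaryGroup_iff]
    ext i j
    fin_cases i <;> fin_cases j <;> simp [Matrix.mul_apply, Fin.sum_univ_two] at h ⊢ <;>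
      first | linear_combination h | ring
  · simp only [det_fin_two_of]
    linear_combination h

theorem eq_of_mem_specialUnitaryGroup_fin_two {U : Matrix (Fin 2) (Fin 2) ℂ}
    (hU : U ∈ specialUnitaryGroup (Fin 2) ℂ) :
    U = !![U 0 0, -star (U 1 0); U 1 0, star (U 0 0)] ∧
      U 0 0 * star (U 0 0) + U 1 0 * star (U 1 0) = 1 := by
  obtain ⟨hu, hd⟩ := mem_specialUnitaryGroup_iff.1 hU
  have hs : star U = adjugate U := by
    calc star U = star U * (U * adjugate U) := by rw [mul_adjugate, hd]; simp
      _ = adjugate U := by rw [← mul_assoc, mem_unitaryGroup_iff'.1 hu, one_mul]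
  rw [adjugate_fin_two] at hs
  have h00 := congrFun₂ hs 0 0
  have h01 := congrFun₂ hs 0 1
  have hl := congrFun₂ (mem_unitaryGroup_iff'.1 hu) 0 0
  simp [Matrix.mul_apply, Fin.sum_univ_two] at h00 h01 hl
  refine ⟨?_, ?_⟩
  · ext i j
    fin_cases i <;> fin_cases j <;> simp [h00, h01]
  · simp only [← starRingEnd_apply]
    linear_combination hl

theorem exists_specialUnitary_mulVec_eq (p q : ℂ) :
    ∃ U ∈ specialUnitaryGroup (Fin 2) ℂ, ∃ r : ℝ, 0 ≤ r ∧
      U 0 0 * p + U 0 1 * q = r ∧ U 1 0 * p + U 1 1 * q = 0 := by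
  by_cases h : p = 0 ∧ q = 0
  · exact ⟨1, one_mem _, 0, le_rfl, by simp [h.1, h.2], by simp [h.1, h.2]⟩
  set r : ℝ := √(Complex.normSq p + Complex.normSq q) with hr
  have hpos : 0 < Complex.normSq p + Complex.normSq q := by
    by_cases hp : p = 0
    · have hq : q ≠ 0 := fun hq => h ⟨hp, hq⟩
      have := Complex.normSq_pos.2 hq
      have := Complex.normSq_nonneg p
      linarith
    · have := Complex.normSq_pos.2 hp
      have := Complex.normSq_nonneg q
      linarith
  have hr0 : (r : ℂ) ≠ 0 := by
    exact_mod_cast (Real.sqrt_pos.2 hpos).ne'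
  have hr2 : (r : ℂ) * r = p * star p + q * star q := by
    simp only [← starRingEnd_apply, Complex.mul_conj]
    exact_mod_cast Real.mul_self_sqrt hpos.le
  refine ⟨!![star p / r, -star (-q / r); -q / r, star (star p / r)],
    mem_specialUnitaryGroup_fin_two_of ?_, r, Real.sqrt_nonneg _, ?_, ?_⟩
  · simp at hr2 ⊢
    field_simp
    linear_combination -hr2
  · simp at hr2 ⊢
    field_simp
    linear_combination -hr2
  · simp
    field_simp
    ring

theorem exists_commutator_of_mem_specialUnitaryGroup {U : Matrix (Fin 2) (Fin 2) ℂ}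
    (hU : U ∈ specialUnitaryGroup (Fin 2) ℂ) :
    ∃ P ∈ specialUnitaryGroup (Fin 2) ℂ, ∃ V ∈ specialUnitaryGroup (Fin 2) ℂ,
      U = P * (star V * pauliX * V) * star P * star (star V * pauliX * V) := by
  obtain ⟨z, hz⟩ := Module.End.exists_eigenvalue (Matrix.toLin' U)
  obtain ⟨v, hv⟩ := hz.exists_hasEigenvector
  have hev : U *ᵥ v = z • v := by simpa using hv.apply_eq_smul
  obtain ⟨V, hV, r, -, h0, h1⟩ := exists_specialUnitary_mulVec_eq (v 0) (v 1)
  have hVu := (mem_specialUnitaryGroup_iff.1 hV).1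
  have hVV := mem_unitaryGroup_iff'.1 hVu
  have hVV' := mem_unitaryGroup_iff.1 hVu
  have hVv : V *ᵥ v = ![(r : ℂ), 0] := by
    ext i
    fin_cases i
    · simpa [Matrix.mulVec, dotProduct, Fin.sum_univ_two] using h0
    · simpa [Matrix.mulVec, dotProduct, Fin.sum_univ_two] using h1
  have hr : (r : ℂ) ≠ 0 := by
    intro hr
    apply hv.2
    rw [← one_mulVec v, ← hVV, ← mulVec_mulVec, hVv, hr]
    ext i
    fin_cases i <;> simp [Matrix.mulVec, dotProduct, Fin.sum_univ_two]
  have hstar : star V ∈ specialUnitaryGroup (Fin 2) ℂ := star_mem_specialUnitaryGroup hV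
  set E := V * U * star V with hE
  have hEmem : E ∈ specialUnitaryGroup (Fin 2) ℂ := mul_mem (mul_mem hV hU) hstar
  have hEv : E *ᵥ ![(r : ℂ), 0] = z • ![(r : ℂ), 0] := by
    rw [← hVv, hE, mulVec_mulVec, mul_assoc, hVV, mul_one, ← mulVec_mulVec, hev, mulVec_smul]
  have e0 := congrFun hEv 0
  have e1 := congrFun hEv 1
  simp [Matrix.mulVec, dotProduct, Fin.sum_univ_two, hr] at e0 e1
  obtain ⟨hEeq, hEn⟩ := eq_of_mem_specialUnitaryGroup_fin_two hEmem
  rw [e0, e1] at hEeq hEn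
  obtain ⟨w, hw⟩ := IsAlgClosed.exists_pow_nat_eq z (n := 2) (by norm_num)
  have hwn : w * star w = 1 := by
    have h1 : ‖z‖ = 1 := by
      simp [Complex.mul_conj] at hEn
      have : Complex.normSq z = 1 := by exact_mod_cast hEn
      rw [Complex.normSq_eq_norm_sq] at this
      nlinarith [norm_nonneg z]
    have h2 : ‖w‖ = 1 := by
      rw [← hw, norm_pow] at h1
      nlinarith [norm_nonneg w]
    simp [Complex.mul_conj, Complex.normSq_eq_norm_sq, h2]
  set D : Matrix (Fin 2) (Fin 2) ℂ := !![w, -star 0; 0, star w] with hD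
  have hDmem : D ∈ specialUnitaryGroup (Fin 2) ℂ :=
    mem_specialUnitaryGroup_fin_two_of (by simpa using hwn)
  have hcomm : E = D * pauliX * star D * star pauliX := by
    rw [hEeq, hD, ← hw]
    ext i j
    fin_cases i <;> fin_cases j <;>
      simp [pauliX, Matrix.mul_apply, Fin.sum_univ_two, Matrix.star_apply, Matrix.vecMul,
        dotProduct, sq]
  refine ⟨star V * D * V, mul_mem (mul_mem hstar hDmem) hV, V, hV, ?_⟩
  have hUE : U = star V * E * V := by
    rw [hE]
    simp only [mul_assoc, hVV, mul_one]
    rw [← mul_assoc, hVV, one_mul]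
  rw [hUE, hcomm]
  have key (M : Matrix (Fin 2) (Fin 2) ℂ) : V * (star V * M) = M := by
    rw [← mul_assoc, hVV', one_mul]
  simp only [star_mul, star_star, mul_assoc, key]

theorem exists_specialUnitary_commutator {U : Matrix (Fin 2) (Fin 2) ℂ}
    (hU : U ∈ specialUnitaryGroup (Fin 2) ℂ) :
    ∃ P ∈ specialUnitaryGroup (Fin 2) ℂ, ∃ Q ∈ specialUnitaryGroup (Fin 2) ℂ,
      U = P * Q * star P * star Q := by
  obtain ⟨P, hP, V, hV, h⟩ := exists_commutator_of_mem_specialUnitaryGroup hU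
  have hX : Complex.I • pauliX ∈ specialUnitaryGroup (Fin 2) ℂ := by
    convert mem_specialUnitaryGroup_fin_two_of (a := 0) (b := Complex.I) (by simp) using 1
    ext i j
    fin_cases i <;> fin_cases j <;> simp [pauliX]
  refine ⟨P, hP, star V * (Complex.I • pauliX) * V, mul_mem (mul_mem (star_mem_specialUnitaryGroup hV) hX) hV, ?_⟩
  rw [h]
  simp [smul_smul]

section TwoLevel

variable {ι : Type*} [DecidableEq ι]

/-- The matrix acting as `U` on the ordered pair of coordinates `(x, y)` and as the identity on
all other coordinates. -/
def twoLevel (x y : ι) (U : Matrix (Fin 2) (Fin 2) ℂ) : Matrix ι ι ℂ :=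
  Matrix.of fun i j =>
    if i = x then (if j = x then U 0 0 else if j = y then U 0 1 else 0)
    else if i = y then (if j = x then U 1 0 else if j = y then U 1 1 else 0)
    else if i = j then 1 else 0

variable [Fintype ι]

theorem twoLevel_mulVec {x y : ι} (hxy : x ≠ y) (U : Matrix (Fin 2) (Fin 2) ℂ) (v : ι → ℂ)
    (i : ι) :
    (twoLevel x y U *ᵥ v) i =
      if i = x then U 0 0 * v x + U 0 1 * v y
      else if i = y then U 1 0 * v x + U 1 1 * v y else v i := by
  have key (a b : ℂ) : ∑ j, (if j = x then a else if j = y then b else 0) * v j =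
      a * v x + b * v y := by
    rw [Finset.sum_eq_add x y hxy]
    · simp [hxy.symm]
    · intro j _ hj
      simp [hj.1, hj.2]
    · simp
    · simp
  simp only [Matrix.mulVec, dotProduct, twoLevel, Matrix.of_apply]
  split_ifs
  · exact key _ _
  · exact key _ _
  · simp

theorem twoLevel_one {x y : ι} (hxy : x ≠ y) : twoLevel x y 1 = 1 := by
  refine Matrix.mulVec_injective (funext fun v => funext fun i => ?_)
  rw [twoLevel_mulVec hxy]
  split_ifs <;> simp_all

theorem twoLevel_mul {x y : ι} (hxy : x ≠ y) (U V : Matrix (Fin 2) (Fin 2) ℂ) :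
    twoLevel x y (U * V) = twoLevel x y U * twoLevel x y V := by
  refine Matrix.mulVec_injective (funext fun v => funext fun i => ?_)
  rw [← mulVec_mulVec]
  simp only [twoLevel_mulVec hxy, Matrix.mul_apply, Fin.sum_univ_two, if_true, hxy.symm, if_false]
  split_ifs <;> ring

theorem twoLevel_swap {x y : ι} (hxy : x ≠ y) (U : Matrix (Fin 2) (Fin 2) ℂ) :
    twoLevel y x U = twoLevel x y (pauliX * U * pauliX) := by
  refine Matrix.mulVec_injective (funext fun v => funext fun i => ?_)
  simp only [twoLevel_mulVec hxy, twoLevel_mulVec hxy.symm]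
  split_ifs <;> simp_all [pauliX, Matrix.vecMul, Matrix.mul_apply, dotProduct, Fin.sum_univ_two, add_comm]

theorem twoLevel_conj {x y z : ι} (hxy : x ≠ y) (hyz : y ≠ z) (hxz : x ≠ z)
    (U : Matrix (Fin 2) (Fin 2) ℂ) :
    twoLevel x z U =
      twoLevel x y !![0, 1; -1, 0] * twoLevel y z U * twoLevel x y !![0, -1; 1, 0] := by
  refine Matrix.mulVec_injective (funext fun v => funext fun i => ?_)
  simp only [← mulVec_mulVec, twoLevel_mulVec hxy, twoLevel_mulVec hyz, twoLevel_mulVec hxz]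
  by_cases h1 : i = x
  · subst h1
    simp [hxy.symm, hyz.symm, hxz.symm]
  by_cases h2 : i = y
  · subst h2
    simp [hxy, hxy.symm, hxz, hyz]
  by_cases h3 : i = z
  · subst h3
    simp [hxy.symm, hyz.symm, hxz.symm]
  simp [h1, h2, h3]

theorem det_twoLevel {x y : ι} (hxy : x ≠ y) {U : Matrix (Fin 2) (Fin 2) ℂ}
    (hU : U ∈ specialUnitaryGroup (Fin 2) ℂ) : (twoLevel x y U).det = 1 := by
  have key {P : Matrix (Fin 2) (Fin 2) ℂ} (hP : P ∈ specialUnitaryGroup (Fin 2) ℂ) :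
      (twoLevel x y P).det * (twoLevel x y (star P)).det = 1 := by
    rw [← det_mul, ← twoLevel_mul hxy,
      mem_unitaryGroup_iff.1 (mem_specialUnitaryGroup_iff.1 hP).1, twoLevel_one hxy, det_one]
  obtain ⟨P, hP, Q, hQ, rfl⟩ := exists_specialUnitary_commutator hU
  simp only [twoLevel_mul hxy, det_mul]
  linear_combination key hP + key hQ * (twoLevel x y P).det * (twoLevel x y (star P)).det

end TwoLevel

section Elimination

variable {ι : Type*} [DecidableEq ι] [Fintype ι]

theorem star_mulVec_eq_of_mulVec_eq {A : Matrix ι ι ℂ} (hA : A ∈ unitaryGroup ι ℂ)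
    {v : ι → ℂ} (h : A *ᵥ v = v) : star A *ᵥ v = v := by
  conv_lhs => rw [← h]
  rw [mulVec_mulVec, mem_unitaryGroup_iff'.1 hA, one_mulVec]

theorem exists_mem_mulVec_eq_zero (M : Submonoid (Matrix ι ι ℂ))
    (hM : ∀ x y, x ≠ y → ∀ U ∈ specialUnitaryGroup (Fin 2) ℂ, twoLevel x y U ∈ M)
    (x : ι) (v : ι → ℂ) (T : Finset ι) (hx : x ∉ T) :
    ∃ g ∈ M, g.det = 1 ∧ (∀ i ∉ insert x T, g *ᵥ Pi.single i 1 = Pi.single i 1) ∧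
      (∀ i ∈ T, (g *ᵥ v) i = 0) ∧ (T.Nonempty → ∃ r : ℝ, 0 ≤ r ∧ (g *ᵥ v) x = r) := by
  induction T using Finset.induction_on with
  | empty => exact ⟨1, one_mem _, by simp, fun i _ => one_mulVec _, by simp, by simp⟩
  | insert y T hy ih =>
    rw [Finset.mem_insert, not_or] at hx
    obtain ⟨g, hg, hdet, hfix, hzero, -⟩ := ih hx.2
    obtain ⟨U, hU, r, hr, h0, h1⟩ :=
      exists_specialUnitary_mulVec_eq ((g *ᵥ v) x) ((g *ᵥ v) y)
    refine ⟨twoLevel x y U * g, mul_mem (hM x y hx.1 U hU) hg, ?_, ?_, ?_, ?_⟩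
    · rw [det_mul, det_twoLevel hx.1 hU, hdet, one_mul]
    · intro i hi
      simp only [Finset.mem_insert, not_or] at hi
      rw [← mulVec_mulVec, hfix i (by simp [hi.1, hi.2.2])]
      funext j
      rw [twoLevel_mulVec hx.1]
      split_ifs with hjx hjy
      · subst hjx
        simp [Ne.symm hi.1, Ne.symm hi.2.1]
      · subst hjy
        simp [Ne.symm hi.1, Ne.symm hi.2.1]
      · rfl
    · intro i hi
      rw [← mulVec_mulVec, twoLevel_mulVec hx.1]
      by_cases hiy : i = y
      · simp [hiy, Ne.symm hx.1, h1]
      · have hiT : i ∈ T := (Finset.mem_insert.1 hi).resolve_left hiy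
        have hix : i ≠ x := fun h => hx.2 (h ▸ hiT)
        simp [hiy, hix, hzero i hiT]
    · intro _
      refine ⟨r, hr, ?_⟩
      rw [← mulVec_mulVec, twoLevel_mulVec hx.1]
      simp [h0]

theorem mem_of_forall_twoLevel_mem (M : Submonoid (Matrix ι ι ℂ))
    (hunit : ∀ A ∈ M, A ∈ unitaryGroup ι ℂ) (hstar : ∀ A ∈ M, star A ∈ M)
    (hM : ∀ x y, x ≠ y → ∀ U ∈ specialUnitaryGroup (Fin 2) ℂ, twoLevel x y U ∈ M)
    (S : Finset ι) : ∀ A ∈ specialUnitaryGroup ι ℂ,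
      (∀ i ∉ S, A *ᵥ Pi.single i 1 = Pi.single i 1) → A ∈ M := by
  have ext_single {A : Matrix ι ι ℂ} (h : ∀ i, A *ᵥ Pi.single i 1 = Pi.single i 1) : A = 1 := by
    ext i j
    have := congrFun (h j) i
    simpa [Matrix.one_apply, Pi.single_apply] using this
  induction S using Finset.induction_on with
  | empty =>
    intro A _ h
    rw [ext_single fun i => h i (by simp)]
    exact one_mem _
  | insert x T hx ih =>
    intro A hA hfix
    obtain ⟨g, hg, hgdet, hgfix, hgzero, hgx⟩ :=
      exists_mem_mulVec_eq_zero M hM x (A *ᵥ Pi.single x 1) T hx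
    have hgA : g * A ∈ specialUnitaryGroup ι ℂ := mul_mem
      (mem_specialUnitaryGroup_iff.2 ⟨hunit g hg, hgdet⟩) hA
    obtain ⟨hu, hdet⟩ := mem_specialUnitaryGroup_iff.1 hgA
    have hfix' (i) (hi : i ∉ insert x T) : (g * A) *ᵥ Pi.single i 1 = Pi.single i 1 := by
      rw [← mulVec_mulVec, hfix i hi, hgfix i hi]
    have hcol (i) (hi : i ≠ x) : (g * A) i x = 0 := by
      by_cases hiT : i ∈ T
      · have := hgzero i hiT
        rw [mulVec_mulVec] at this
        simpa using this
      · have := congrFun (star_mulVec_eq_of_mulVec_eq hu (hfix' i (by simp [hi, hiT]))) x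
        rw [mulVec_single_one, col_apply, Matrix.star_apply, Pi.single_eq_of_ne hi.symm] at this
        simpa only [star_eq_zero] using this
    have hnorm : star ((g * A) x x) * (g * A) x x = 1 := by
      have := congrFun₂ (mem_unitaryGroup_iff'.1 hu) x x
      rwa [Matrix.mul_apply, Finset.sum_eq_single x (by
        intro i _ hi
        rw [hcol i hi, mul_zero]) (by simp), Matrix.star_apply, Matrix.one_apply_eq] at this
    have hxx : (g * A) x x = 1 := by
      by_cases hT : T.Nonempty
      · obtain ⟨r, hr, h⟩ := hgx hT
        rw [mulVec_mulVec] at h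
        have h' : (g * A) x x = r := by simpa using h
        rw [h'] at hnorm ⊢
        have : r * r = 1 := by
          have : ((r * r : ℝ) : ℂ) = 1 := by simpa using hnorm
          exact_mod_cast this
        have : r = 1 := by nlinarith
        simp [this]
      · rw [Finset.not_nonempty_iff_eq_empty] at hT
        subst hT
        have hdiag : g * A = diagonal (Function.update 1 x ((g * A) x x)) := by
          ext i j
          by_cases hj : j = x
          · subst hj
            by_cases hi : i = j
            · subst hi; simp
            · rw [hcol i hi, diagonal_apply_ne _ hi]
          · have := congrFun (hfix' j (by simpa using hj)) i
            by_cases hi : i = j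
            · subst hi
              simpa [hj] using this
            · rw [diagonal_apply_ne _ hi]
              simpa [hi] using this
        rw [hdiag, det_diagonal, Finset.prod_update_of_mem (Finset.mem_univ x)] at hdet
        simpa using hdet
    have hmem : g * A ∈ M := by
      refine ih _ hgA fun i hi => ?_
      by_cases hix : i = x
      · subst hix
        funext j
        by_cases hj : j = i
        · subst hj
          simpa using hxx
        · simpa [hj] using hcol j hj
      · exact hfix' i (by simp [hix, hi])
    have : A = star g * (g * A) := by
      rw [← mul_assoc, mem_unitaryGroup_iff'.1 (hunit g hg), one_mul]
    rw [this]
    exact mul_mem (hstar g hg) hmem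

theorem twoLevel_mem_trans (M : Submonoid (Matrix ι ι ℂ)) {x y z : ι} (hxz : x ≠ z)
    (h₁ : x ≠ y → ∀ U ∈ specialUnitaryGroup (Fin 2) ℂ, twoLevel x y U ∈ M)
    (h₂ : y ≠ z → ∀ U ∈ specialUnitaryGroup (Fin 2) ℂ, twoLevel y z U ∈ M) :
    ∀ U ∈ specialUnitaryGroup (Fin 2) ℂ, twoLevel x z U ∈ M := by
  intro U hU
  by_cases hxy : x = y
  · subst hxy
    exact h₂ hxz U hU
  by_cases hyz : y = z
  · subst hyz
    exact h₁ hxz U hU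
  rw [twoLevel_conj hxy hyz hxz]
  refine mul_mem (mul_mem (h₁ hxy _ ?_) (h₂ hyz U hU)) (h₁ hxy _ ?_)
  · simpa using mem_specialUnitaryGroup_fin_two_of (a := 0) (b := -1) (by simp)
  · simpa using mem_specialUnitaryGroup_fin_two_of (a := 0) (b := 1) (by simp)

end Elimination

section Multiplexed

variable {N : ℕ}

/-- The uniformly controlled one-qubit gate with target `k`: on the block of basis vectors that
agree with `b` off `k`, it acts on qubit `k` by the value of `f` at `b` with its `k`-th bit
cleared. -/
def multiplexed (k : Fin N) (f : (Fin N → Fin 2) → Matrix (Fin 2) (Fin 2) ℂ) :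
    Matrix (Fin N → Fin 2) (Fin N → Fin 2) ℂ :=
  Matrix.of fun r c =>
    if Function.update r k 0 = Function.update c k 0 then f (Function.update r k 0) (r k) (c k)
    else 0

theorem update_zero_eq_update_zero_iff {k : Fin N} {r c : Fin N → Fin 2} :
    Function.update r k 0 = Function.update c k 0 ↔ c = Function.update r k (c k) := by
  constructor
  · intro h
    funext j
    by_cases hj : j = k
    · subst hj; simp
    · simpa [hj] using (congrFun h j).symm
  · intro h
    rw [h]
    simp

theorem multiplexed_mulVec (k : Fin N) (f : (Fin N → Fin 2) → Matrix (Fin 2) (Fin 2) ℂ)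
    (v : (Fin N → Fin 2) → ℂ) (b : Fin N → Fin 2) :
    (multiplexed k f *ᵥ v) b =
      f (Function.update b k 0) (b k) 0 * v (Function.update b k 0) +
        f (Function.update b k 0) (b k) 1 * v (Function.update b k 1) := by
  have hne : Function.update b k 0 ≠ Function.update b k 1 := fun h => by
    simpa using congrFun h k
  simp only [Matrix.mulVec, dotProduct, multiplexed, Matrix.of_apply]
  rw [Finset.sum_eq_add _ _ hne]
  · simp
  · intro c _ hc
    rw [if_neg, zero_mul]
    intro h
    rw [update_zero_eq_update_zero_iff] at h
    have : c k = 0 ∨ c k = 1 := by omega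
    rcases this with h0 | h0 <;> rw [h0] at h
    exacts [hc.1 h, hc.2 h]
  · simp
  · simp

theorem multiplexed_one (k : Fin N) : multiplexed k 1 = 1 := by
  ext r c
  simp only [multiplexed, Matrix.of_apply, update_zero_eq_update_zero_iff, Pi.one_apply,
    Matrix.one_apply]
  by_cases h : r = c
  · subst h; simp
  · rw [if_neg h, ite_eq_right_iff]
    intro h1
    rw [if_neg]
    intro h2
    rw [← h2, Function.update_eq_self] at h1
    exact h h1.symm

theorem multiplexed_mul (k : Fin N) (f g : (Fin N → Fin 2) → Matrix (Fin 2) (Fin 2) ℂ) :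
    multiplexed k (f * g) = multiplexed k f * multiplexed k g := by
  refine Matrix.mulVec_injective (funext fun v => funext fun b => ?_)
  rw [← mulVec_mulVec]
  simp only [multiplexed_mulVec, Pi.mul_apply, Matrix.mul_apply, Fin.sum_univ_two,
    Function.update_self, Function.update_idem]
  ring

theorem star_multiplexed (k : Fin N) (f : (Fin N → Fin 2) → Matrix (Fin 2) (Fin 2) ℂ) :
    star (multiplexed k f) = multiplexed k (star f) := by
  ext r c
  simp only [multiplexed, Matrix.star_apply, Matrix.of_apply, Pi.star_apply]
  by_cases h : Function.update r k 0 = Function.update c k 0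
  · simp [h]
  · simp [h, Ne.symm h]

theorem multiplexed_mem_unitaryGroup (k : Fin N)
    {f : (Fin N → Fin 2) → Matrix (Fin 2) (Fin 2) ℂ} (hf : ∀ b, f b ∈ unitaryGroup (Fin 2) ℂ) :
    multiplexed k f ∈ unitaryGroup (Fin N → Fin 2) ℂ := by
  rw [mem_unitaryGroup_iff, star_multiplexed, ← multiplexed_mul, ← multiplexed_one k]
  congr 1
  funext b
  exact mem_unitaryGroup_iff.1 (hf b)

theorem localGate_eq_multiplexed (k : Fin N) (U : Matrix (Fin 2) (Fin 2) ℂ) :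
    localGate k U = multiplexed k fun _ => U := by
  ext r c
  simp only [localGate, tensorString, multiplexed, Matrix.of_apply]
  split_ifs with h
  · rw [Finset.prod_eq_single k]
    · simp
    · intro j _ hj
      have : r j = c j := by simpa [hj] using congrFun h j
      rw [if_neg hj, this, Matrix.one_apply_eq]
    · simp
  · obtain ⟨j, hj⟩ := Function.ne_iff.1 h
    by_cases hjk : j = k
    · subst hjk; simp at hj
    · refine Finset.prod_eq_zero (Finset.mem_univ j) ?_
      simp only [hjk, ne_eq, not_false_eq_true, Function.update_of_ne] at hj
      simp [hjk, hj]

theorem cnot_eq_multiplexed {j k : Fin N} (hjk : j ≠ k) :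
    cnot j k = multiplexed k fun b => if b j = 1 then pauliX else 1 := by
  refine Matrix.mulVec_injective (funext fun v => funext fun b => ?_)
  rw [multiplexed_mulVec]
  have h : ∀ c : Fin N → Fin 2,
      b = Function.update c k (c j + c k) ↔ c = Function.update b k (b j + b k) := by
    have aux (b c : Fin N → Fin 2) (h : b = Function.update c k (c j + c k)) :
        c = Function.update b k (b j + b k) := by
      rw [h]
      funext i
      by_cases hi : i = k
      · subst hi
        simp only [Function.update_self, Function.update_of_ne hjk]
        omega
      · simp [hi]
    exact fun c => ⟨aux b c, aux c b⟩
  have hb : Function.update b k (b k) = b := Function.update_eq_self _ _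
  simp only [Matrix.mulVec, dotProduct, cnot, Matrix.of_apply, h, ite_mul, one_mul, zero_mul,
    Finset.sum_ite_eq', Finset.mem_univ, if_true, Function.update_of_ne hjk]
  have h1 : b j = 0 ∨ b j = 1 := by omega
  have h2 : b k = 0 ∨ b k = 1 := by omega
  rcases h1 with h1 | h1 <;> rcases h2 with h2 | h2 <;>
    simp [h1, h2, pauliX, Matrix.one_apply]

theorem twoLevel_eq_multiplexed (k : Fin N) (x : Fin N → Fin 2) (U : Matrix (Fin 2) (Fin 2) ℂ) :
    twoLevel (Function.update x k 0) (Function.update x k 1) U =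
      multiplexed k fun b => if ∀ j ∈ Finset.univ.erase k, b j = x j then U else 1 := by
  have hne : Function.update x k 0 ≠ Function.update x k 1 := fun h => by
    simpa using congrFun h k
  refine Matrix.mulVec_injective (funext fun v => funext fun b => ?_)
  rw [multiplexed_mulVec, twoLevel_mulVec hne]
  have h2 : b k = 0 ∨ b k = 1 := by omega
  by_cases h : ∀ j ∈ Finset.univ.erase k, Function.update b k 0 j = x j
  · rw [if_pos h]
    have hb (s : Fin 2) : Function.update b k s = Function.update x k s := by
      funext i
      by_cases hi : i = k
      · subst hi; simp
      · simpa [hi] using h i (by simp [hi])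
    have hb' : b = Function.update x k (b k) := by
      rw [← hb, Function.update_eq_self]
    rw [hb 0, hb 1]
    rcases h2 with h2 | h2 <;> rw [h2] at hb' ⊢ <;> simp [hb', hne.symm]
  · rw [if_neg h]
    have hb (s : Fin 2) : b ≠ Function.update x k s := by
      rintro rfl
      refine h fun j hj => ?_
      simp [Finset.ne_of_mem_erase hj]
    rw [if_neg (hb 0), if_neg (hb 1)]
    have hb' : Function.update b k (b k) = b := Function.update_eq_self _ _
    rcases h2 with h2 | h2 <;> rw [h2] at hb' ⊢ <;> simp [hb']

section Controlled

variable (M : Submonoid (Matrix (Fin N → Fin 2) (Fin N → Fin 2) ℂ)) (k : Fin N)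

/-- `M` contains all special unitary gates on qubit `k` controlled by the predicate `p`. -/
def ContainsControlled (p : (Fin N → Fin 2) → Prop) [DecidablePred p] : Prop :=
  ∀ U ∈ specialUnitaryGroup (Fin 2) ℂ, multiplexed k (fun b => if p b then U else 1) ∈ M

variable {M k}

theorem ContainsControlled.and (hstar : ∀ A ∈ M, star A ∈ M) {p q : (Fin N → Fin 2) → Prop}
    [DecidablePred p] [DecidablePred q] (hp : ContainsControlled M k p)
    (hq : ContainsControlled M k q) : ContainsControlled M k fun b => p b ∧ q b := by
  intro U hU
  obtain ⟨P, hP, Q, hQ, rfl⟩ := exists_specialUnitary_commutator hU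
  have h := mul_mem (mul_mem (mul_mem (hp P hP) (hq Q hQ)) (hstar _ (hp P hP)))
    (hstar _ (hq Q hQ))
  rw [star_multiplexed, star_multiplexed, ← multiplexed_mul, ← multiplexed_mul,
    ← multiplexed_mul] at h
  convert h using 2
  funext b
  have hPP := mem_unitaryGroup_iff.1 (mem_specialUnitaryGroup_iff.1 hP).1
  have hQQ := mem_unitaryGroup_iff.1 (mem_specialUnitaryGroup_iff.1 hQ).1
  by_cases h1 : p b <;> by_cases h2 : q b <;> simp [h1, h2, hPP, hQQ]

theorem containsControlled_eq_one (hstar : ∀ A ∈ M, star A ∈ M)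
    (hloc : ∀ U ∈ unitaryGroup (Fin 2) ℂ, localGate k U ∈ M) {j : Fin N} (hjk : j ≠ k)
    (hcnot : cnot j k ∈ M) : ContainsControlled M k fun b => b j = 1 := by
  intro U hU
  obtain ⟨P, hP, V, hV, rfl⟩ := exists_commutator_of_mem_specialUnitaryGroup hU
  have hPu := (mem_specialUnitaryGroup_iff.1 hP).1
  have hVu := (mem_specialUnitaryGroup_iff.1 hV).1
  have hX := mul_mem (mul_mem (hloc _ (Unitary.star_mem hVu)) hcnot) (hloc V hVu)
  have h := mul_mem (mul_mem (mul_mem (hloc P hPu) hX) (hstar _ (hloc P hPu))) (hstar _ hX)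
  simp only [localGate_eq_multiplexed, cnot_eq_multiplexed hjk, star_multiplexed,
    ← multiplexed_mul] at h
  convert h using 2
  funext b
  have hPP := mem_unitaryGroup_iff.1 hPu
  have hVV := mem_unitaryGroup_iff'.1 hVu
  by_cases h1 : b j = 1 <;> simp [h1, hPP, hVV]

theorem containsControlled_eq (hstar : ∀ A ∈ M, star A ∈ M)
    (hloc : ∀ U ∈ unitaryGroup (Fin 2) ℂ, localGate k U ∈ M) {j : Fin N} (hjk : j ≠ k)
    (hcnot : cnot j k ∈ M) (s : Fin 2) : ContainsControlled M k fun b => b j = s := by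
  have h1 := containsControlled_eq_one hstar hloc hjk hcnot
  have hs : s = 0 ∨ s = 1 := by omega
  rcases hs with rfl | rfl
  · intro U hU
    have hUu := (mem_specialUnitaryGroup_iff.1 hU).1
    have h := mul_mem (hloc U hUu) (hstar _ (h1 U hU))
    simp only [localGate_eq_multiplexed, star_multiplexed, ← multiplexed_mul] at h
    convert h using 2
    funext b
    have hUU := mem_unitaryGroup_iff.1 hUu
    have hb : b j = 0 ∨ b j = 1 := by omega
    rcases hb with hb | hb <;> simp [hb, hUU]
  · exact h1

theorem containsControlled_forall_mem (hstar : ∀ A ∈ M, star A ∈ M)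
    (hloc : ∀ U ∈ unitaryGroup (Fin 2) ℂ, localGate k U ∈ M)
    (hcnot : ∀ j, j ≠ k → cnot j k ∈ M) (x : Fin N → Fin 2) (T : Finset (Fin N)) (hT : k ∉ T) :
    ContainsControlled M k fun b => ∀ j ∈ T, b j = x j := by
  induction T using Finset.induction_on with
  | empty =>
    intro U hU
    have := hloc U (mem_specialUnitaryGroup_iff.1 hU).1
    simpa [localGate_eq_multiplexed] using this
  | insert j T hj ih =>
    rw [Finset.mem_insert, not_or] at hT
    have h := (containsControlled_eq hstar hloc (Ne.symm hT.1) (hcnot j (Ne.symm hT.1)) (x j)).and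
      hstar (ih hT.2)
    intro U hU
    simpa only [Finset.forall_mem_insert] using h U hU

end Controlled

theorem twoLevel_update_mem {M : Submonoid (Matrix (Fin N → Fin 2) (Fin N → Fin 2) ℂ)}
    (hstar : ∀ A ∈ M, star A ∈ M)
    (hloc : ∀ k, ∀ U ∈ unitaryGroup (Fin 2) ℂ, localGate k U ∈ M)
    (hcnot : ∀ j k, j ≠ k → cnot j k ∈ M) (k : Fin N) (x : Fin N → Fin 2) (s : Fin 2)
    (hs : x ≠ Function.update x k s) (U : Matrix (Fin 2) (Fin 2) ℂ)
    (hU : U ∈ specialUnitaryGroup (Fin 2) ℂ) : twoLevel x (Function.update x k s) U ∈ M := by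
  have key (U) (hU : U ∈ specialUnitaryGroup (Fin 2) ℂ) :
      twoLevel (Function.update x k 0) (Function.update x k 1) U ∈ M := by
    rw [twoLevel_eq_multiplexed]
    exact containsControlled_forall_mem hstar (hloc k) (fun j => hcnot j k) x _ (by simp) U hU
  have hx : Function.update x k (x k) = x := Function.update_eq_self _ _
  have h1 : s = 0 ∨ s = 1 := by omega
  have h2 : x k = 0 ∨ x k = 1 := by omega
  rcases h1 with rfl | rfl <;> rcases h2 with h2 | h2 <;> rw [h2] at hx
  · exact absurd hx.symm hs
  · have := key (pauliX * U * pauliX) ?_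
    · rwa [← twoLevel_swap, hx] at this
      rw [hx]
      exact hs.symm
    · obtain ⟨hu, hd⟩ := mem_specialUnitaryGroup_iff.1 hU
      refine mem_specialUnitaryGroup_iff.2
        ⟨mul_mem (mul_mem pauliX_mem_unitaryGroup hu) pauliX_mem_unitaryGroup, ?_⟩
      rw [det_mul, det_mul, hd]
      simp [pauliX]
  · simpa only [hx] using key U hU
  · exact absurd hx.symm hs

theorem twoLevel_mem_of_forall_gate_mem
    {M : Submonoid (Matrix (Fin N → Fin 2) (Fin N → Fin 2) ℂ)} (hstar : ∀ A ∈ M, star A ∈ M)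
    (hloc : ∀ k, ∀ U ∈ unitaryGroup (Fin 2) ℂ, localGate k U ∈ M)
    (hcnot : ∀ j k, j ≠ k → cnot j k ∈ M) (x y : Fin N → Fin 2) (hxy : x ≠ y) :
    ∀ U ∈ specialUnitaryGroup (Fin 2) ℂ, twoLevel x y U ∈ M := by
  have key (T : Finset (Fin N)) : x ≠ T.piecewise y x →
      ∀ U ∈ specialUnitaryGroup (Fin 2) ℂ, twoLevel x (T.piecewise y x) U ∈ M := by
    induction T using Finset.induction_on with
    | empty => exact fun h => absurd (by simp) h
    | insert k T _ ih =>
      intro h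
      refine twoLevel_mem_trans M h ih fun h' => ?_
      rw [Finset.piecewise_insert] at h' ⊢
      exact twoLevel_update_mem hstar hloc hcnot k _ _ h'
  simpa [hxy] using key Finset.univ

end Multiplexed

/-- (Strong universality of C-NOT for complex quantum computation)  For `N ≥ 2`, the subgroup
of `U(2^N)` generated by the embedded C-NOT gates and the local one-qubit unitary gates contains
every unitary of determinant `1`, i.e. all of `SU(2^N)`. -/
theorem cnot_strongly_universal_CQT (N : ℕ) (hN : 2 ≤ N) :
    ∀ A : Matrix.unitaryGroup (Fin N → Fin 2) ℂ,
      (A : Matrix (Fin N → Fin 2) (Fin N → Fin 2) ℂ).det = 1 →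
      A ∈ Subgroup.closure
        {W : Matrix.unitaryGroup (Fin N → Fin 2) ℂ |
          (∃ j k, j ≠ k ∧ (W : Matrix (Fin N → Fin 2) (Fin N → Fin 2) ℂ) = cnot j k) ∨
          (∃ (k : Fin N) (U : Matrix (Fin 2) (Fin 2) ℂ), U ∈ Matrix.unitaryGroup (Fin 2) ℂ ∧
            (W : Matrix (Fin N → Fin 2) (Fin N → Fin 2) ℂ) = localGate k U)} := by
  intro A hA
  set K := Subgroup.closure
        {W : Matrix.unitaryGroup (Fin N → Fin 2) ℂ |
          (∃ j k, j ≠ k ∧ (W : Matrix (Fin N → Fin 2) (Fin N → Fin 2) ℂ) = cnot j k) ∨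
          (∃ (k : Fin N) (U : Matrix (Fin 2) (Fin 2) ℂ), U ∈ Matrix.unitaryGroup (Fin 2) ℂ ∧
            (W : Matrix (Fin N → Fin 2) (Fin N → Fin 2) ℂ) = localGate k U)} with hK
  let M := K.toSubmonoid.map (unitaryGroup (Fin N → Fin 2) ℂ).subtype
  have hunit (B) (hB : B ∈ M) : B ∈ unitaryGroup (Fin N → Fin 2) ℂ := by
    obtain ⟨W, -, rfl⟩ := hB
    exact W.2
  have hstar (B) (hB : B ∈ M) : star B ∈ M := by
    obtain ⟨W, hW, rfl⟩ := hB
    exact ⟨W⁻¹, K.inv_mem hW, rfl⟩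
  have hloc (k : Fin N) (U) (hU : U ∈ unitaryGroup (Fin 2) ℂ) : localGate k U ∈ M :=
    ⟨⟨localGate k U, by
      rw [localGate_eq_multiplexed]
      exact multiplexed_mem_unitaryGroup k fun _ => hU⟩,
      Subgroup.subset_closure (Or.inr ⟨k, U, hU, rfl⟩), rfl⟩
  have hcnot (j k : Fin N) (hjk : j ≠ k) : cnot j k ∈ M :=
    ⟨⟨cnot j k, by
      rw [cnot_eq_multiplexed hjk]
      refine multiplexed_mem_unitaryGroup k fun b => ?_
      split_ifs
      exacts [pauliX_mem_unitaryGroup, one_mem _]⟩,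
      Subgroup.subset_closure (Or.inl ⟨j, k, hjk, rfl⟩), rfl⟩
  obtain ⟨W, hW, hWA⟩ := mem_of_forall_twoLevel_mem M hunit hstar
    (twoLevel_mem_of_forall_gate_mem hstar hloc hcnot) Finset.univ A
    (mem_specialUnitaryGroup_iff.2 ⟨A.2, hA⟩) (by simp)
  rwa [← Subtype.ext hWA]
end
end
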